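/- Let R be a Boolean ring, I an ideal of R, and E a binary relation on R satisfying the edge property (E f g implies (f+1)*g ∈ I) and skew-symmetry (E f g implies E (g+1) (f+1)). If f, g ∈ R are mutually reachable, i.e., the reflexive-transitive closure of E relates f to g and also relates g to f (f and g lie in the same strongly connected component of the implication graph), then f + g ∈ I. -/

import Mathlib

/-- If `E` satisfies the edge property with respect to an ideal `I` of a
Boolean ring and is skew-symmetric, and `f`, `g` are mutually reachable in the
implication graph (they lie in the same strongly connected component), then
`f + g ∈ I`. -/
theorem scc_linear_polynomial (R : Type*) [BooleanRing R] (I : Ideal R)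
    (E : R → R → Prop)
    (hE : ∀ f g, E f g → (f + 1) * g ∈ I)
    (hskew : ∀ f g, E f g → E (g + 1) (f + 1))
    (f g : R)
    (hfg : Relation.ReflTransGen E f g)
    (hgf : Relation.ReflTransGen E g f) :
    f + g ∈ I := by
  have key : ∀ a b, Relation.ReflTransGen E a b → (a + 1) * b ∈ I := by
    intro a b h
    induction h with
    | refl =>
      have : (a + 1) * a = 0 := by
        rw [add_mul, one_mul, BooleanRing.mul_self, BooleanRing.add_self]
      rw [this]
      exact I.zero_mem
    | @tail b c _ hbc ih =>
      have h2 : b + b = 0 := BooleanRing.add_self b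
      have : (a + 1) * c = (a + 1) * ((b + 1) * c) + c * ((a + 1) * b) := by
        linear_combination (-(a + 1) * c) * h2
      rw [this]
      exact I.add_mem (I.mul_mem_left _ (hE _ _ hbc)) (I.mul_mem_left _ ih)
  have h2 : f * g + f * g = 0 := BooleanRing.add_self _
  have : f + g = (f + 1) * g + (g + 1) * f := by
    linear_combination -h2
  rw [this]
  exact I.add_mem (key _ _ hfg) (key _ _ hgf)
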